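/- Let n ≥ 2 be an integer. Let φ, ψ be smooth functions of (x, t) on an open set, with φ > 0, ψ > 0, satisfying φ_t = n·(ψ_ss/ψ)·φ and ψ_t = ψ_ss − (n−1)·(1 − ψ_s²)/ψ, where ∂_s := φ^{−1}·∂_x and t-derivatives are at fixed x. Suppose ψ_s < 0 throughout the region considered, so that for each t the map s ↦ ψ(s, t) is invertible and s may be regarded as a smooth function of (ψ, t). Define z(ψ, t) := (ψ_s)², expressed as a function of the new variables (ψ, t). Then z satisfies z_t = F_ψ[z], where the t-derivative is taken at fixed ψ and F_ψ[z] := (1/ψ²)·{ ψ²·z·z_ψψ − (1/2)·(ψ·z_ψ)² + (n−1−z)·ψ·z_ψ + 2(n−1)·(1−z)·z }. -/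

import Mathlib

lemma tip_hasX (F : ℝ × ℝ → ℝ) (x t : ℝ) (h : DifferentiableAt ℝ F (x, t)) :
    HasDerivAt (fun x' => F (x', t)) (fderiv ℝ F (x, t) (1, 0)) x := by
  have h1 : HasDerivAt (fun x' : ℝ => (x', t)) ((1 : ℝ), (0 : ℝ)) x :=
    (hasDerivAt_id x).prodMk (hasDerivAt_const x t)
  exact h.hasFDerivAt.comp_hasDerivAt x h1

lemma tip_hasT (F : ℝ × ℝ → ℝ) (x t : ℝ) (h : DifferentiableAt ℝ F (x, t)) :
    HasDerivAt (fun t' => F (x, t')) (fderiv ℝ F (x, t) (0, 1)) t := by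
  have h1 : HasDerivAt (fun t' : ℝ => (x, t')) ((0 : ℝ), (1 : ℝ)) t :=
    (hasDerivAt_const t x).prodMk (hasDerivAt_id t)
  exact h.hasFDerivAt.comp_hasDerivAt t h1

lemma tip_smooth (F : ℝ × ℝ → ℝ) (Ω : Set (ℝ × ℝ)) (hΩ : IsOpen Ω)
    (h : ContDiffOn ℝ (⊤ : ℕ∞) F Ω) (v : ℝ × ℝ) :
    ContDiffOn ℝ (⊤ : ℕ∞) (fun q => fderiv ℝ F q v) Ω :=
  (h.fderiv_of_isOpen hΩ (by simp)).clm_apply contDiffOn_const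

lemma tip_comm (F : ℝ × ℝ → ℝ) (p : ℝ × ℝ) (h : ContDiffAt ℝ 2 F p) (v w : ℝ × ℝ) :
    fderiv ℝ (fun q => fderiv ℝ F q v) p w = fderiv ℝ (fun q => fderiv ℝ F q w) p v := by
  have hd : DifferentiableAt ℝ (fderiv ℝ F) p :=
    (h.fderiv_right (m := 1) (by norm_num)).differentiableAt (by norm_num)
  have key : ∀ v w, fderiv ℝ (fun q => fderiv ℝ F q v) p w = fderiv ℝ (fderiv ℝ F) p w v := by
    intro v w
    have := hd.hasFDerivAt.clm_apply (hasFDerivAt_const v p)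
    rw [this.fderiv]; simp
  rw [key, key]
  exact (h.isSymmSndFDerivAt (by simp)) w v

lemma tip_open (F : ℝ × ℝ → ℝ) (x t : ℝ) (Ω : Set (ℝ × ℝ)) (hΩ : Ω ∈ nhds (x, t))
    (h : ContDiffAt ℝ 1 F (x, t)) (h0 : fderiv ℝ F (x, t) (1, 0) ≠ 0) :
    {q : ℝ × ℝ | ∃ x' : ℝ, (x', q.2) ∈ Ω ∧ F (x', q.2) = q.1} ∈ nhds (F (x, t), t) := by
  have hs : HasStrictFDerivAt F (fderiv ℝ F (x, t)) (x, t) := h.hasStrictFDerivAt (by norm_num)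
  have hG := hs.prodMk (hasStrictFDerivAt_snd (𝕜 := ℝ) (E := ℝ) (F := ℝ) (p := (x, t)))
  have hr : ((fderiv ℝ F (x, t)).prod (ContinuousLinearMap.snd ℝ ℝ ℝ)).range = ⊤ := by
    rw [LinearMap.range_eq_top]
    rintro ⟨a, b⟩
    refine ⟨((a - b * fderiv ℝ F (x, t) (0, 1)) / fderiv ℝ F (x, t) (1, 0), b), ?_⟩
    have : ∀ c d : ℝ, ((c, d) : ℝ × ℝ) = c • ((1 : ℝ), (0 : ℝ)) + d • ((0 : ℝ), (1 : ℝ)) := by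
      intro c d; simp
    ext
    · simp only [ContinuousLinearMap.coe_coe, ContinuousLinearMap.prod_apply]
      generalize fderiv ℝ F (x, t) = L at *
      rw [this (_ / _) b, map_add, map_smul, map_smul]
      simp only [smul_eq_mul]
      field_simp
      ring
    · simp
  have hm := hG.map_nhds_eq_of_surj hr
  have : (fun q : ℝ × ℝ => (F q, q.2)) '' Ω ∈ nhds (F (x, t), t) := by
    rw [← hm]; exact Filter.image_mem_map hΩ
  refine Filter.mem_of_superset this ?_
  rintro _ ⟨⟨a, b⟩, hab, rfl⟩
  exact ⟨a, hab, rfl⟩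


/-- The arclength derivative `(D_s f)(x,t) = φ(x,t)⁻¹ · ∂_x f(x,t)`. -/
noncomputable def arclengthDeriv (φ f : ℝ → ℝ → ℝ) (x t : ℝ) : ℝ :=
  deriv (fun x' => f x' t) x / φ x t

/-- The tip operator
`F_ψ[z] = ψ⁻² { ψ² z z_ψψ - (1/2)(ψ z_ψ)² + (n-1-z) ψ z_ψ + 2(n-1)(1-z) z }`. -/
noncomputable def tipOp (n : ℕ) (z : ℝ → ℝ) (p : ℝ) : ℝ :=
  (1 / p ^ 2) * (p ^ 2 * z p * deriv (deriv z) p - (1 / 2) * (p * deriv z p) ^ 2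
    + ((n : ℝ) - 1 - z p) * p * deriv z p + 2 * ((n : ℝ) - 1) * (1 - z p) * z p)

/-- Near the tip, where `ψ_s < 0` so that `ψ` serves as a radial coordinate, the
quantity `z = (ψ_s)²`, regarded as a function of `(ψ, t)`, evolves by
`z_t = F_ψ[z]` along a rotationally symmetric Ricci flow. -/
theorem tip_coordinate_evolution (n : ℕ) (hn : 2 ≤ n)
    (Ω : Set (ℝ × ℝ)) (hΩ : IsOpen Ω) (φ ψ : ℝ → ℝ → ℝ)
    (hφ : ContDiffOn ℝ (⊤ : ℕ∞) (fun p : ℝ × ℝ => φ p.1 p.2) Ω)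
    (hψ : ContDiffOn ℝ (⊤ : ℕ∞) (fun p : ℝ × ℝ => ψ p.1 p.2) Ω)
    (hφpos : ∀ x t : ℝ, (x, t) ∈ Ω → 0 < φ x t)
    (hψpos : ∀ x t : ℝ, (x, t) ∈ Ω → 0 < ψ x t)
    (hφEq : ∀ x t : ℝ, (x, t) ∈ Ω →
      deriv (fun t' => φ x t') t =
        (n : ℝ) * (arclengthDeriv φ (arclengthDeriv φ ψ) x t / ψ x t) * φ x t)
    (hψEq : ∀ x t : ℝ, (x, t) ∈ Ω →
      deriv (fun t' => ψ x t') t =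
        arclengthDeriv φ (arclengthDeriv φ ψ) x t
          - ((n : ℝ) - 1) * (1 - (arclengthDeriv φ ψ x t) ^ 2) / ψ x t)
    (hψs : ∀ x t : ℝ, (x, t) ∈ Ω → arclengthDeriv φ ψ x t < 0)
    (hinj : ∀ t : ℝ, Set.InjOn (fun x => ψ x t) {x : ℝ | (x, t) ∈ Ω})
    (z : ℝ → ℝ → ℝ)
    (hz : ContDiffOn ℝ 2 (fun q : ℝ × ℝ => z q.1 q.2)
      {q : ℝ × ℝ | ∃ x : ℝ, (x, q.2) ∈ Ω ∧ ψ x q.2 = q.1})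
    (hzdef : ∀ x t : ℝ, (x, t) ∈ Ω → z (ψ x t) t = (arclengthDeriv φ ψ x t) ^ 2) :
    ∀ x t : ℝ, (x, t) ∈ Ω →
      deriv (fun t' => z (ψ x t) t') t = tipOp n (fun p => z p t) (ψ x t) := by
  set U : Set (ℝ × ℝ) := {q : ℝ × ℝ | ∃ x : ℝ, (x, q.2) ∈ Ω ∧ ψ x q.2 = q.1} with hU
  set Φ : ℝ × ℝ → ℝ := fun p => φ p.1 p.2 with hΦ
  set Ψ : ℝ × ℝ → ℝ := fun p => ψ p.1 p.2 with hΨ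
  set Z : ℝ × ℝ → ℝ := fun p => z p.1 p.2 with hZ
  set W : ℝ × ℝ → ℝ := fun p => fderiv ℝ Ψ p (1, 0) / Φ p with hW
  set V : ℝ × ℝ → ℝ := fun p => fderiv ℝ W p (1, 0) / Φ p with hV
  have hΦ0 : ∀ p ∈ Ω, Φ p ≠ 0 := fun p hp => (hφpos p.1 p.2 hp).ne'
  have hΨ0 : ∀ p ∈ Ω, Ψ p ≠ 0 := fun p hp => (hψpos p.1 p.2 hp).ne'
  have hWs : ContDiffOn ℝ (⊤ : ℕ∞) W Ω := (tip_smooth Ψ Ω hΩ hψ _).div hφ hΦ0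
  have hVs : ContDiffOn ℝ (⊤ : ℕ∞) V Ω := (tip_smooth W Ω hΩ hWs _).div hφ hΦ0
  have hdiff : ∀ F : ℝ × ℝ → ℝ, ContDiffOn ℝ (⊤ : ℕ∞) F Ω → ∀ p ∈ Ω, DifferentiableAt ℝ F p :=
    fun F hF p hp => (hF.contDiffAt (hΩ.mem_nhds hp)).differentiableAt (by simp)
  have hevx : ∀ x t, (x, t) ∈ Ω → ∀ᶠ x' in nhds x, (x', t) ∈ Ω := by
    intro x t h
    have hc : ContinuousAt (fun x' : ℝ => (x', t)) x := by fun_prop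
    exact hc.eventually (hΩ.mem_nhds h)
  have hevt : ∀ x t, (x, t) ∈ Ω → ∀ᶠ t' in nhds t, (x, t') ∈ Ω := by
    intro x t h
    have hc : ContinuousAt (fun t' : ℝ => (x, t')) t := by fun_prop
    exact hc.eventually (hΩ.mem_nhds h)
  have hA1 : ∀ x t, (x, t) ∈ Ω → arclengthDeriv φ ψ x t = W (x, t) := by
    intro x t h
    have := (tip_hasX Ψ x t (hdiff Ψ hψ _ h)).deriv
    simp only [arclengthDeriv, hW]
    rw [← this]
  have hA2 : ∀ x t, (x, t) ∈ Ω → arclengthDeriv φ (arclengthDeriv φ ψ) x t = V (x, t) := by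
    intro x t h
    have h1 := (tip_hasX W x t (hdiff W hWs _ h)).deriv
    have h2 : (fun x' => arclengthDeriv φ ψ x' t) =ᶠ[nhds x] fun x' => W (x', t) := by
      filter_upwards [hevx x t h] with x' hx' using hA1 x' t hx'
    rw [arclengthDeriv, h2.deriv_eq, h1]
  have hW0 : ∀ p ∈ Ω, W p ≠ 0 := by
    intro p hp
    have := hψs p.1 p.2 hp
    rw [hA1 p.1 p.2 hp] at this
    exact this.ne
  have hXΨ : ∀ p ∈ Ω, fderiv ℝ Ψ p (1, 0) = W p * Φ p := fun p hp => by
    simp only [hW]; rw [div_mul_cancel₀ _ (hΦ0 p hp)]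
  have hXW : ∀ p ∈ Ω, fderiv ℝ W p (1, 0) = V p * Φ p := fun p hp => by
    simp only [hV]; rw [div_mul_cancel₀ _ (hΦ0 p hp)]
  have hTΦ : ∀ p ∈ Ω, fderiv ℝ Φ p (0, 1) = n * (V p / Ψ p) * Φ p := by
    rintro ⟨x, t⟩ h
    rw [← (tip_hasT Φ x t (hdiff Φ hφ _ h)).deriv, ← hA2 x t h]
    exact hφEq x t h
  have hTΨ : ∀ p ∈ Ω, fderiv ℝ Ψ p (0, 1) = V p - ((n : ℝ) - 1) * (1 - W p ^ 2) / Ψ p := by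
    rintro ⟨x, t⟩ h
    rw [← (tip_hasT Ψ x t (hdiff Ψ hψ _ h)).deriv, ← hA2 x t h, ← hA1 x t h]
    exact hψEq x t h
  have hUn : ∀ x t, (x, t) ∈ Ω → U ∈ nhds (ψ x t, t) := by
    intro x t h
    refine tip_open Ψ x t Ω (hΩ.mem_nhds h) ((hψ.contDiffAt (hΩ.mem_nhds h)).of_le (by simp)) ?_
    rw [hXΨ _ h]
    exact mul_ne_zero (hW0 _ h) (hΦ0 _ h)
  have hZc : ∀ x t, (x, t) ∈ Ω → ContDiffAt ℝ 2 Z (ψ x t, t) :=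
    fun x t h => hz.contDiffAt (hUn x t h)
  have hZd : ∀ x t, (x, t) ∈ Ω → DifferentiableAt ℝ Z (ψ x t, t) :=
    fun x t h => (hZc x t h).differentiableAt (by norm_num)
  have hZW : ∀ x t, (x, t) ∈ Ω → Z (ψ x t, t) = W (x, t) ^ 2 := by
    intro x t h
    rw [← hA1 x t h]; exact hzdef x t h
  -- first spatial derivative
  have hZp : ∀ x t, (x, t) ∈ Ω → fderiv ℝ Z (ψ x t, t) (1, 0) = 2 * V (x, t) := by
    intro x t h
    have h1 := (tip_hasX Z (ψ x t) t (hZd x t h)).comp x (tip_hasX Ψ x t (hdiff Ψ hψ _ h))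
    have h2 := (tip_hasX W x t (hdiff W hWs _ h)).pow 2
    have h3 : (fun x' => Z (ψ x' t, t)) =ᶠ[nhds x] fun x' => W (x', t) ^ 2 := by
      filter_upwards [hevx x t h] with x' hx' using hZW x' t hx'
    have h4 := h1.unique (h2.congr_of_eventuallyEq h3)
    rw [hXΨ _ h, hXW _ h] at h4
    have a := hW0 _ h
    have b := hΦ0 _ h
    apply mul_right_cancel₀ (mul_ne_zero a b)
    rw [h4]; push_cast; ring
  intro x t h
  have a := hW0 _ h
  have b := hΦ0 _ h
  have c := hΨ0 _ h
  have hZpd : DifferentiableAt ℝ (fun q => fderiv ℝ Z q (1, 0)) (ψ x t, t) :=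
    (((hZc x t h).fderiv_right (m := 1) (by norm_num)).differentiableAt (by norm_num)).clm_apply
      (differentiableAt_const _)
  have hVx := tip_hasX V x t (hdiff V hVs _ h)
  have hZpp : fderiv ℝ (fun q => fderiv ℝ Z q (1, 0)) (ψ x t, t) (1, 0) * (W (x, t) * Φ (x, t)) =
      2 * fderiv ℝ V (x, t) (1, 0) := by
    have h1 := (tip_hasX _ (ψ x t) t hZpd).comp x (tip_hasX Ψ x t (hdiff Ψ hψ _ h))
    have h2 := hVx.const_mul 2
    have h3 : (fun x' => fderiv ℝ Z (ψ x' t, t) (1, 0)) =ᶠ[nhds x] fun x' => 2 * V (x', t) := by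
      filter_upwards [hevx x t h] with x' hx' using hZp x' t hx'
    have h4 := h1.unique (h2.congr_of_eventuallyEq h3)
    rw [hXΨ _ h] at h4
    exact h4
  -- time derivative of z along the flow
  have hZt : fderiv ℝ Z (ψ x t, t) (1, 0) * fderiv ℝ Ψ (x, t) (0, 1)
      + fderiv ℝ Z (ψ x t, t) (0, 1) = 2 * W (x, t) * fderiv ℝ W (x, t) (0, 1) := by
    have h0 := (tip_hasT Ψ x t (hdiff Ψ hψ _ h)).prodMk (hasDerivAt_id t)
    have h1 : HasDerivAt (fun t' => Z (ψ x t', t'))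
        (fderiv ℝ Z (ψ x t, t) (fderiv ℝ Ψ (x, t) (0, 1), 1)) t :=
      HasFDerivAt.comp_hasDerivAt (f := fun t' => (Ψ (x, t'), id t')) t
        (hZd x t h).hasFDerivAt h0
    have h2 := (tip_hasT W x t (hdiff W hWs _ h)).pow 2
    have h3 : (fun t' => Z (ψ x t', t')) =ᶠ[nhds t] fun t' => W (x, t') ^ 2 := by
      filter_upwards [hevt x t h] with t' ht' using hZW x t' ht'
    have h4 := h1.unique (h2.congr_of_eventuallyEq h3)
    have h5 : ((fderiv ℝ Ψ (x, t) (0, 1), 1) : ℝ × ℝ) =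
        fderiv ℝ Ψ (x, t) (0, 1) • ((1 : ℝ), (0 : ℝ)) + ((0 : ℝ), (1 : ℝ)) := by simp
    rw [h5, map_add, map_smul, smul_eq_mul] at h4
    rw [mul_comm, h4]; push_cast; ring
  -- commutator
  have hmix : fderiv ℝ (fun q => fderiv ℝ Ψ q (1, 0)) (x, t) (0, 1) =
      fderiv ℝ V (x, t) (1, 0) + 2 * ((n : ℝ) - 1) * W (x, t) * (V (x, t) * Φ (x, t)) / Ψ (x, t)
      + ((n : ℝ) - 1) * (1 - W (x, t) ^ 2) * (W (x, t) * Φ (x, t)) / Ψ (x, t) ^ 2 := by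
    rw [tip_comm Ψ (x, t) ((hψ.contDiffAt (hΩ.mem_nhds h)).of_le (WithTop.coe_le_coe.2 (le_top : (2 : ℕ∞) ≤ ⊤)))]
    have h1 := tip_hasX _ x t (hdiff _ (tip_smooth Ψ Ω hΩ hψ (0, 1)) _ h)
    have hw := tip_hasX W x t (hdiff W hWs _ h)
    have hp := tip_hasX Ψ x t (hdiff Ψ hψ _ h)
    have h2 := hVx.sub (((((hw.pow 2).const_sub 1).const_mul ((n : ℝ) - 1))).div hp c)
    have h3 : (fun x' => fderiv ℝ Ψ (x', t) (0, 1)) =ᶠ[nhds x]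
        fun x' => V (x', t) - ((n : ℝ) - 1) * (1 - W (x', t) ^ 2) / Ψ (x', t) := by
      filter_upwards [hevx x t h] with x' hx' using hTΨ _ hx'
    have h4 := h1.unique (h2.congr_of_eventuallyEq h3)
    rw [h4, hXΨ _ h, hXW _ h]
    simp only [Pi.pow_apply]
    push_cast
    field_simp
    ring
  have hWt : fderiv ℝ W (x, t) (0, 1) =
      (fderiv ℝ (fun q => fderiv ℝ Ψ q (1, 0)) (x, t) (0, 1) * Φ (x, t)
        - W (x, t) * Φ (x, t) * (n * (V (x, t) / Ψ (x, t)) * Φ (x, t))) / Φ (x, t) ^ 2 := by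
    have h1 := tip_hasT W x t (hdiff W hWs _ h)
    have h2 := (tip_hasT _ x t (hdiff _ (tip_smooth Ψ Ω hΩ hψ (1, 0)) _ h)).div
      (tip_hasT Φ x t (hdiff Φ hφ _ h)) b
    have h4 := h1.unique h2
    rw [h4, hTΦ _ h, hXΨ _ h]
  -- derivatives of z at the point
  have hd1 : ∀ᶠ p in nhds (ψ x t), deriv (fun p => z p t) p = fderiv ℝ Z (p, t) (1, 0) := by
    have hc : ContinuousAt (fun p : ℝ => (p, t)) (ψ x t) := by fun_prop
    filter_upwards [hc.eventually (hUn x t h)] with p hp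
    obtain ⟨x', hx', hxp⟩ := hp
    change ψ x' t = p at hxp
    subst hxp
    exact (tip_hasX Z (ψ x' t) t (hZd x' t hx')).deriv
  have hd2 : deriv (deriv (fun p => z p t)) (ψ x t) =
      fderiv ℝ (fun q => fderiv ℝ Z q (1, 0)) (ψ x t, t) (1, 0) := by
    have h2 : deriv (fun p => z p t) =ᶠ[nhds (ψ x t)] fun p => fderiv ℝ Z (p, t) (1, 0) := hd1
    rw [h2.deriv_eq]
    exact (tip_hasX _ (ψ x t) t hZpd).deriv
  have hdt : deriv (fun t' => z (ψ x t) t') t = fderiv ℝ Z (ψ x t, t) (0, 1) :=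
    (tip_hasT Z (ψ x t) t (hZd x t h)).deriv
  rw [tipOp, hdt, hd2, hd1.self_of_nhds, hZp x t h]
  rw [hZp x t h, hTΨ _ h, hWt, hmix] at hZt
  have hzz : z (ψ x t) t = W (x, t) ^ 2 := hZW x t h
  have hpp : ψ x t = Ψ (x, t) := rfl
  rw [hzz]
  have hZpp' := (eq_div_iff (mul_ne_zero a b)).2 hZpp
  rw [hZpp', eq_sub_of_add_eq' hZt, hpp]
  generalize W (x, t) = w at *
  generalize Φ (x, t) = f at *
  generalize Ψ (x, t) = y at *
  generalize V (x, t) = v at *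
  generalize fderiv ℝ V (x, t) (1, 0) = v' at *
  field_simp
  ring
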